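/- Let q = 2^r with r a positive integer and let a ∈ 𝔽_q^*. Then the number of elements g ∈ SO⁺(4,q) with tr(a·Tr g) = 1 equals (1/2)·q²·(q⁴ − q³ − 2q² + q + 1 − K(λ;a)²) = (1/2)·q²·(q⁴ − q³ − 2q² + 1 − K₂(λ;a)) (where Tr g is the matrix trace). -/

import Mathlib

open Finset Matrix

/-- The quadratic form `θ⁺(x) = ∑ i, x_i x_{n+i}` on `F^{2n}` (columns indexed by `Fin n ⊕ Fin n`). -/
def thetaPlus (F : Type) [Field F] (n : ℕ) (x : Fin n ⊕ Fin n → F) : F :=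
  ∑ i : Fin n, x (Sum.inl i) * x (Sum.inr i)

/-- The orthogonal group `O⁺(2n,q)`: invertible matrices preserving `θ⁺`. -/
noncomputable def OplusGrp (F : Type) [Field F] [Fintype F] [DecidableEq F] (n : ℕ) :
    Finset (Matrix (Fin n ⊕ Fin n) (Fin n ⊕ Fin n) F) := by
  classical
  exact Finset.univ.filter (fun w => IsUnit w ∧
    ∀ x : Fin n ⊕ Fin n → F, thetaPlus F n (w.mulVec x) = thetaPlus F n x)

/-- `SO⁺(2n,q)`: the kernel of `δ⁺(w) = Tr(B ᵗC)` on `O⁺(2n,q)`,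
where `w = [[A,B],[C,D]]` in `n × n` blocks. -/
noncomputable def SOplusGrp (F : Type) [Field F] [Fintype F] [DecidableEq F] (n : ℕ) :
    Finset (Matrix (Fin n ⊕ Fin n) (Fin n ⊕ Fin n) F) := by
  classical
  exact (OplusGrp F n).filter
    (fun w => Matrix.trace (Matrix.toBlocks₁₂ w * (Matrix.toBlocks₂₁ w)ᵀ) = 0)

/-- The trace map `tr(x) = x + x² + ⋯ + x^{2^{r−1}}`, valued in `𝔽₂ = {0,1} ⊆ F`. -/
def trF (F : Type) [Field F] (r : ℕ) (x : F) : F := ∑ i ∈ Finset.range r, x ^ 2 ^ i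

/-- The canonical additive character `λ(x) = (−1)^{tr(x)} ∈ {±1} ⊆ ℤ`. -/
noncomputable def lam (F : Type) [Field F] (r : ℕ) (x : F) : ℤ := by
  classical exact if trF F r x = 0 then 1 else -1

/-- The trace map `tr` viewed as a function into `𝔽₂ = ZMod 2`. -/
noncomputable def tr2 (F : Type) [Field F] (r : ℕ) (x : F) : ZMod 2 := by
  classical exact if trF F r x = 0 then 0 else 1

/-- The Kloosterman sum `K(λ;a) = ∑_{α ∈ F*} λ(α + aα⁻¹)`. -/
noncomputable def Kl (F : Type) [Field F] [Fintype F] (r : ℕ) (a : F) : ℤ := by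
  classical
  exact ∑ α ∈ Finset.univ.filter (fun α : F => α ≠ 0), lam F r (α + a * α⁻¹)

/-- The `m`-dimensional Kloosterman sum
`K_m(λ;a) = ∑_{α₁,…,α_m ∈ F*} λ(α₁ + ⋯ + α_m + aα₁⁻¹⋯α_m⁻¹)`;
for `m = 0` this is `K₀(λ;a) = λ(a)`. -/
noncomputable def Klm (F : Type) [Field F] [Fintype F] (r m : ℕ) (a : F) : ℤ := by
  classical
  exact ∑ v ∈ Finset.univ.filter (fun v : Fin m → F => ∀ i, v i ≠ 0),
    lam F r ((∑ i, v i) + a * (∏ i, v i)⁻¹)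

/-- The power moment `MK^h = ∑_{a ∈ F*} K(λ;a)^h`. -/
noncomputable def MK (F : Type) [Field F] [Fintype F] (r h : ℕ) : ℤ := by
  classical exact ∑ a ∈ Finset.univ.filter (fun a : F => a ≠ 0), (Kl F r a) ^ h

/-- The power moment `MK₂^h = ∑_{a ∈ F*} K₂(λ;a)^h` of 2-dimensional Kloosterman sums. -/
noncomputable def MK2 (F : Type) [Field F] [Fintype F] (r h : ℕ) : ℤ := by
  classical exact ∑ a ∈ Finset.univ.filter (fun a : F => a ≠ 0), (Klm F r 2 a) ^ h

/-- The binary code `C(G) = {u ∈ 𝔽₂^G : ∑_{g ∈ G} u_g Tr(g) = 0 in F}`. -/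
noncomputable def code (F : Type) [Field F] [Fintype F] [DecidableEq F]
    {ι : Type} [Fintype ι] [DecidableEq ι] (G : Finset (Matrix ι ι F)) :
    Finset (↥G → ZMod 2) := by
  classical
  exact Finset.univ.filter
    (fun u => ∑ g : ↥G, (u g).val • Matrix.trace (g : Matrix ι ι F) = 0)

/-- Number of codewords of Hamming weight `j` in the code `C(G)`. -/
noncomputable def wtCount (F : Type) [Field F] [Fintype F] [DecidableEq F]
    {ι : Type} [Fintype ι] [DecidableEq ι] (G : Finset (Matrix ι ι F)) (j : ℕ) : ℕ := by
  classical
  exact ((code F G).filter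
    (fun u => (Finset.univ.filter (fun g : ↥G => u g = 1)).card = j)).card

/-- `t! · S(h,t)` where `S(h,t)` is the Stirling number of the second kind,
`S(h,t) = (1/t!) ∑_{j=0}^{t} (−1)^{t−j} C(t,j) j^h`. -/
def tS (h t : ℕ) : ℤ :=
  ∑ j ∈ Finset.range (t + 1), (-1 : ℤ) ^ (t - j) * (t.choose j : ℤ) * (j : ℤ) ^ h

/-- Binomial coefficient with integer arguments: `0` whenever `k < 0` or `k > n`. -/
def ichoose (n k : ℤ) : ℤ := if 0 ≤ k ∧ k ≤ n then (n.toNat.choose k.toNat : ℤ) else 0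

section Character

variable {F : Type} [Field F]

theorem trF_add [CharP F 2] (r : ℕ) (x y : F) : trF F r (x + y) = trF F r x + trF F r y := by
  unfold trF
  rw [← Finset.sum_add_distrib]
  exact Finset.sum_congr rfl fun i _ => add_pow_char_pow x y 2 i

theorem trF_sq [Fintype F] {r : ℕ} (hF : Fintype.card F = 2 ^ r) (x : F) :
    trF F r (x ^ 2) = trF F r x := by
  have hx : x ^ 2 ^ r = x := by rw [← hF]; exact FiniteField.pow_card x
  have h : ∀ i, (x ^ 2) ^ 2 ^ i = x ^ 2 ^ (i + 1) := fun i => by rw [← pow_mul, pow_succ']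
  have h1 := Finset.sum_range_succ (fun i => x ^ 2 ^ i) r
  have h2 := Finset.sum_range_succ' (fun i => x ^ 2 ^ i) r
  rw [h1] at h2
  simp only [hx, pow_zero, pow_one] at h2
  unfold trF
  simp only [h]
  exact (add_right_cancel h2).symm

theorem sq_trF [CharP F 2] (r : ℕ) (x : F) : trF F r x ^ 2 = trF F r (x ^ 2) := by
  unfold trF
  rw [sum_pow_char 2]
  exact Finset.sum_congr rfl fun i _ => by rw [← pow_mul, ← pow_mul, mul_comm]

theorem trF_eq_zero_or_one [CharP F 2] [Fintype F] {r : ℕ} (hF : Fintype.card F = 2 ^ r) (x : F) :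
    trF F r x = 0 ∨ trF F r x = 1 := by
  have h : trF F r x * (trF F r x - 1) = 0 := by
    linear_combination (sq_trF r x).trans (trF_sq hF x)
  rcases mul_eq_zero.mp h with h | h
  · exact Or.inl h
  · exact Or.inr (sub_eq_zero.mp h)

theorem exists_trF_ne_zero [Fintype F] {r : ℕ} (hr : 1 ≤ r) (hF : Fintype.card F = 2 ^ r) :
    ∃ x : F, trF F r x ≠ 0 := by
  classical
  by_contra! h
  let p : Polynomial F := ∑ i ∈ Finset.range r, Polynomial.X ^ 2 ^ i
  have hp : p = 0 := by
    refine Polynomial.eq_zero_of_natDegree_lt_card_of_eval_eq_zero' p Finset.univ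
      (fun x _ => ?_) ?_
    · simpa [p, trF, Polynomial.eval_finsetSum] using h x
    · rw [Finset.card_univ, hF]
      refine lt_of_le_of_lt (Polynomial.natDegree_sum_le_of_forall_le (n := 2 ^ (r - 1)) _ _
        fun i hi => ?_) (Nat.pow_lt_pow_right one_lt_two (by omega))
      rw [Polynomial.natDegree_X_pow]
      exact Nat.pow_le_pow_right two_pos (by have := Finset.mem_range.mp hi; omega)
  have hc : p.coeff 1 = 1 := by
    have : ∀ i, (1 : ℕ) = 2 ^ i ↔ i = 0 := fun i => by
      rw [eq_comm, Nat.pow_eq_one]; simp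
    simp only [p, Polynomial.finsetSum_coeff, Polynomial.coeff_X_pow, this]
    simp; omega
  simp [hp] at hc

theorem lam_zero (r : ℕ) : lam F r 0 = 1 := by
  simp [lam, trF]

theorem lam_add [CharP F 2] [Fintype F] {r : ℕ} (hF : Fintype.card F = 2 ^ r) (x y : F) :
    lam F r (x + y) = lam F r x * lam F r y := by
  have h2 : (1 : F) + 1 = 0 := CharTwo.add_self_eq_zero 1
  unfold lam
  rw [trF_add]
  rcases trF_eq_zero_or_one hF x with hx | hx <;> rcases trF_eq_zero_or_one hF y with hy | hy <;>
    simp [hx, hy, h2]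

theorem lam_sq [Fintype F] {r : ℕ} (hF : Fintype.card F = 2 ^ r) (x : F) :
    lam F r (x ^ 2) = lam F r x := by
  unfold lam
  rw [trF_sq hF]

theorem sum_lam [CharP F 2] [Fintype F] {r : ℕ} (hr : 1 ≤ r) (hF : Fintype.card F = 2 ^ r) :
    ∑ x : F, lam F r x = 0 := by
  obtain ⟨y, hy⟩ := exists_trF_ne_zero hr hF
  have h1 : lam F r y = -1 := by simp [lam, hy]
  have h2 : ∑ x : F, lam F r x = ∑ x : F, lam F r (x + y) :=
    (Equiv.sum_comp (Equiv.addRight y) (lam F r)).symm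
  simp only [lam_add hF, h1, mul_neg, mul_one, Finset.sum_neg_distrib] at h2
  omega

theorem sum_lam_mul [DecidableEq F] [CharP F 2] [Fintype F] {r : ℕ} (hr : 1 ≤ r)
    (hF : Fintype.card F = 2 ^ r) (b : F) :
    ∑ x : F, lam F r (b * x) = if b = 0 then 2 ^ r else 0 := by
  split_ifs with hb
  · simp [hb, lam_zero, hF]
  · rw [← sum_lam hr hF]
    exact Equiv.sum_comp (Equiv.mulLeft₀ b hb) (lam F r)

theorem card_filter_trF_eq_one [CharP F 2] [Fintype F] [DecidableEq F] {r : ℕ}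
    (hF : Fintype.card F = 2 ^ r) {ι : Type*} (s : Finset ι) (f : ι → F) :
    2 * ((s.filter fun i => trF F r (f i) = 1).card : ℤ) =
      s.card - ∑ i ∈ s, lam F r (f i) := by
  rw [Finset.card_filter, Finset.card_eq_sum_ones]
  push_cast
  rw [← Finset.sum_sub_distrib, Finset.mul_sum]
  refine Finset.sum_congr rfl fun i _ => ?_
  unfold lam
  rcases trF_eq_zero_or_one hF (f i) with h | h <;> simp [h]

theorem units_add_inv_eq_zero_iff [CharP F 2] (u : Fˣ) : (u : F) + (u : F)⁻¹ = 0 ↔ u = 1 := by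
  rw [CharTwo.add_eq_zero, ← mul_eq_one_iff_eq_inv₀ u.ne_zero]
  constructor
  · intro h
    refine Units.ext (CharTwo.sq_injective (R := F) ?_)
    simpa [sq] using h
  · rintro rfl
    simp

end Character

section Kloosterman

variable {F : Type} [Field F] [Fintype F] [DecidableEq F]

theorem sum_filter_ne_zero {M : Type*} [AddCommMonoid M] (f : F → M) :
    ∑ x ∈ Finset.univ.filter (fun x : F => x ≠ 0), f x = ∑ u : Fˣ, f u := by
  refine (Finset.sum_bij (fun (u : Fˣ) _ => (u : F)) ?_ ?_ ?_ ?_).symm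
  · simp
  · intro u _ v _ h
    exact Units.ext h
  · intro x hx
    exact ⟨Units.mk0 x (by simpa using hx), by simp⟩
  · simp

theorem Kl_eq (r : ℕ) (a : F) : Kl F r a = ∑ u : Fˣ, lam F r (u + a * (u : F)⁻¹) := by
  classical
  unfold Kl
  convert sum_filter_ne_zero (fun x : F => lam F r (x + a * x⁻¹))

theorem Klm_two_eq (r : ℕ) (a : F) : Klm F r 2 a =
    ∑ u : Fˣ, ∑ v : Fˣ, lam F r (u + (v + a * ((u : F)⁻¹ * (v : F)⁻¹))) := by
  classical
  unfold Klm
  rw [← Fintype.sum_prod_type']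
  symm
  refine Finset.sum_bij (fun (p : Fˣ × Fˣ) _ => ![(p.1 : F), (p.2 : F)]) ?_ ?_ ?_ ?_
  · simp [Fin.forall_fin_two]
  · rintro ⟨u, v⟩ _ ⟨u', v'⟩ _ h
    have h0 := congrFun h 0
    have h1 := congrFun h 1
    simp only [Matrix.cons_val_zero, Matrix.cons_val_one] at h0 h1
    exact Prod.ext (Units.ext h0) (Units.ext h1)
  · intro v hv
    have hv' : ∀ i, v i ≠ 0 := by simpa using hv
    refine ⟨(Units.mk0 (v 0) (hv' 0), Units.mk0 (v 1) (hv' 1)), by simp, ?_⟩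
    ext i
    fin_cases i <;> simp
  · rintro ⟨u, v⟩ _
    simp [Fin.sum_univ_two, Fin.prod_univ_two, mul_comm, add_assoc]

theorem sum_units_sq [CharP F 2] {M : Type*} [AddCommMonoid M] (f : Fˣ → M) :
    ∑ u : Fˣ, f (u ^ 2) = ∑ u : Fˣ, f u := by
  have hinj : Function.Injective fun u : Fˣ => u ^ 2 := fun u v h => by
    have h' : (u : F) ^ 2 = (v : F) ^ 2 := by simpa using congrArg Units.val h
    exact Units.ext (CharTwo.sq_injective h')
  exact (Finite.injective_iff_bijective.mp hinj).sum_comp f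

theorem Kl_eq_sum_mul [CharP F 2] {r : ℕ} (hF : Fintype.card F = 2 ^ r) {a : F} (ha : a ≠ 0) :
    ∑ u : Fˣ, lam F r (a * (u + (u : F)⁻¹)) = Kl F r a := by
  rw [Kl_eq, ← Equiv.sum_comp (Equiv.mulLeft (Units.mk0 a ha)⁻¹), ← sum_units_sq]
  refine Finset.sum_congr rfl fun u _ => ?_
  rw [← lam_sq hF (u + a * (u : F)⁻¹), add_pow_char]
  have := u.ne_zero
  congr 1
  simp
  field_simp

theorem sum_units_lam [CharP F 2] {r : ℕ} (hr : 1 ≤ r) (hF : Fintype.card F = 2 ^ r) :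
    ∑ u : Fˣ, lam F r (u : F) = -1 := by
  have h := sum_lam hr hF
  rw [← Finset.add_sum_erase _ _ (Finset.mem_univ (0 : F)), lam_zero] at h
  rw [← sum_filter_ne_zero (fun x : F => lam F r x), Finset.filter_ne']
  linarith

theorem card_units_int {r : ℕ} (hF : Fintype.card F = 2 ^ r) :
    (Fintype.card Fˣ : ℤ) = 2 ^ r - 1 := by
  rw [Fintype.card_units, hF]
  push_cast [Nat.one_le_two_pow]
  ring

theorem sum_sum_lam_add_inv [CharP F 2] {r : ℕ} (hF : Fintype.card F = 2 ^ r)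
    {a : F} (ha : a ≠ 0) :
    ∑ u : Fˣ, ∑ v : Fˣ, lam F r (a * (u + (u : F)⁻¹) * (v + (v : F)⁻¹)) = Kl F r a ^ 2 := by
  have hdiv : ∀ v : Fˣ, ∑ u : Fˣ, lam F r (a * (u + (u : F)⁻¹) * (v + (v : F)⁻¹)) =
      ∑ u : Fˣ, lam F r (a * ((u * v ^ 2 : Fˣ) + ((u * v ^ 2 : Fˣ) : F)⁻¹)) *
        lam F r (a * (u + (u : F)⁻¹)) := fun v => by
    rw [← Equiv.sum_comp (Equiv.mulRight v)]
    refine Finset.sum_congr rfl fun u _ => ?_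
    rw [← lam_add hF]
    have := u.ne_zero
    have := v.ne_zero
    congr 1
    simp
    field_simp
    ring
  rw [Finset.sum_comm]
  simp only [hdiv]
  rw [Finset.sum_comm, sq, ← Kl_eq_sum_mul hF ha, Finset.mul_sum]
  refine Finset.sum_congr rfl fun u _ => ?_
  rw [← Finset.sum_mul]
  congr 1
  rw [sum_units_sq (fun v => lam F r (a * ((u * v : Fˣ) + ((u * v : Fˣ) : F)⁻¹)))]
  exact Equiv.sum_comp (Equiv.mulLeft u) fun w : Fˣ => lam F r (a * ((w : F) + (w : F)⁻¹))

theorem Kl_sq [CharP F 2] {r : ℕ} (hr : 1 ≤ r) (hF : Fintype.card F = 2 ^ r)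
    {a : F} (ha : a ≠ 0) : Kl F r a ^ 2 = Klm F r 2 a + 2 ^ r := by
  have h : ∀ u : Fˣ, ∑ v : Fˣ, lam F r (a * (u + (u : F)⁻¹) * (v + (v : F)⁻¹)) =
      Kl F r (a * (u + (u : F)⁻¹)) + if u = 1 then 2 ^ r else 0 := fun u => by
    by_cases hu : u = 1
    · have h0 := (units_add_inv_eq_zero_iff u).mpr hu
      rw [h0, Kl_eq]
      simp [lam_zero, hu, sum_units_lam hr hF]
      linear_combination card_units_int hF
    · rw [Kl_eq_sum_mul hF (mul_ne_zero ha (mt (units_add_inv_eq_zero_iff u).mp hu))]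
      simp [hu]
  rw [← sum_sum_lam_add_inv hF ha]
  simp only [h, Finset.sum_add_distrib, Finset.sum_ite_eq', Finset.mem_univ, if_true]
  congr 1
  simp only [Kl_eq]
  rw [Finset.sum_comm, Klm_two_eq]
  refine Finset.sum_congr rfl fun u _ => ?_
  simp only [lam_add hF (u : F), ← Finset.mul_sum]
  congr 1
  have hR : ∑ v : Fˣ, lam F r (v + a * ((u : F)⁻¹ * (v : F)⁻¹)) = Kl F r (a * (u : F)⁻¹) := by
    simp only [Kl_eq, mul_assoc]
  rw [hR, ← Kl_eq_sum_mul hF (mul_ne_zero ha (inv_ne_zero u.ne_zero))]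
  refine Finset.sum_congr rfl fun v _ => ?_
  congr 1
  ring

end Kloosterman

section SpecialLinear

variable {F : Type} [Field F] [Fintype F] [DecidableEq F]

theorem sum_sum_ite_mul_eq (c : F) :
    ∑ y : F, ∑ z : F, (if y * z = c then 1 else 0 : ℤ) =
      (Fintype.card F - 1) + if c = 0 then (Fintype.card F : ℤ) else 0 := by
  have h : ∀ y : F, ∑ z : F, (if y * z = c then 1 else 0 : ℤ) =
      1 + if y = 0 then (if c = 0 then (Fintype.card F : ℤ) else 0) - 1 else 0 := fun y => by
    by_cases hy : y = 0
    · by_cases hc : c = 0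
      · simp [hy, hc]
      · simp [hy, hc, Ne.symm hc]
    · have : ∀ z, y * z = c ↔ z = y⁻¹ * c := fun z => by
        rw [eq_inv_mul_iff_mul_eq₀ hy]
      simp [this, hy]
  simp only [h, Finset.sum_add_distrib, Finset.sum_ite_eq', Finset.mem_univ, if_true]
  simp
  ring

theorem sum_specialLinearGroup_eq_ite (f : F → F → ℤ) :
    ∑ g : SpecialLinearGroup (Fin 2) F, f (g.1 0 0) (g.1 1 1) =
      ∑ x : F, ∑ w : F, ∑ y : F, ∑ z : F, if y * z = x * w - 1 then f x w else 0 := by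
  simp only [← Fintype.sum_prod_type']
  rw [← Finset.sum_filter]
  refine Finset.sum_bij (fun g _ => (g.1 0 0, g.1 1 1, g.1 0 1, g.1 1 0)) ?_ ?_ ?_ ?_
  · intro g _
    have := g.2
    rw [Matrix.det_fin_two] at this
    simp only [Finset.mem_filter, Finset.mem_univ, true_and]
    linear_combination -this
  · intro g _ h _ e
    simp only [Prod.mk.injEq] at e
    ext i j
    fin_cases i <;> fin_cases j <;> simp [e]
  · rintro ⟨x, w, y, z⟩ hp
    simp only [Finset.mem_filter, Finset.mem_univ, true_and] at hp
    refine ⟨⟨!![x, y; z, w], ?_⟩, Finset.mem_univ _, by simp⟩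
    rw [Matrix.det_fin_two_of]
    linear_combination -hp
  · simp

theorem sum_sum_ite_mul_eq_one (f : F → F → ℤ) :
    ∑ x : F, ∑ w : F, (if x * w = 1 then f x w else 0) = ∑ u : Fˣ, f u (u : F)⁻¹ := by
  rw [← sum_filter_ne_zero (fun x : F => f x x⁻¹), Finset.sum_filter]
  refine Finset.sum_congr rfl fun x _ => ?_
  by_cases hx : x = 0
  · simp [hx]
  · have : ∀ w, x * w = 1 ↔ w = x⁻¹ := fun w => by
      rw [mul_comm, mul_eq_one_iff_eq_inv₀ hx]
    simp [this, hx]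

theorem sum_specialLinearGroup (f : F → F → ℤ) :
    ∑ g : SpecialLinearGroup (Fin 2) F, f (g.1 0 0) (g.1 1 1) =
      (Fintype.card F - 1) * ∑ x : F, ∑ w : F, f x w +
        Fintype.card F * ∑ u : Fˣ, f u (u : F)⁻¹ := by
  rw [sum_specialLinearGroup_eq_ite, ← sum_sum_ite_mul_eq_one]
  simp only [Finset.mul_sum, ← Finset.sum_add_distrib]
  refine Finset.sum_congr rfl fun x _ => Finset.sum_congr rfl fun w _ => ?_
  have h : ∀ y z : F, (if y * z = x * w - 1 then f x w else 0) =
      f x w * if y * z = x * w - 1 then 1 else 0 := fun y z => by simp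
  simp only [h, ← Finset.mul_sum, sum_sum_ite_mul_eq, sub_eq_zero]
  split_ifs <;> ring

theorem card_specialLinearGroup {r : ℕ} (hF : Fintype.card F = 2 ^ r) :
    (Fintype.card (SpecialLinearGroup (Fin 2) F) : ℤ) = (2 ^ r) ^ 3 - 2 ^ r := by
  have h := sum_specialLinearGroup (F := F) fun _ _ => 1
  simp only [Finset.sum_const, Finset.card_univ, nsmul_eq_mul, mul_one, card_units_int hF] at h
  rw [h, hF]
  push_cast
  ring

variable [CharP F 2] {r : ℕ}

theorem sum_lam_mul_trace (hr : 1 ≤ r) (hF : Fintype.card F = 2 ^ r) (b : F) :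
    ∑ g : SpecialLinearGroup (Fin 2) F, lam F r (b * (g.1 0 0 + g.1 1 1)) =
      (if b = 0 then (2 ^ r - 1) * (2 ^ r) ^ 2 else 0) +
        2 ^ r * ∑ u : Fˣ, lam F r (b * (u + (u : F)⁻¹)) := by
  rw [sum_specialLinearGroup fun x w => lam F r (b * (x + w))]
  simp only [mul_add b, lam_add hF (b * _), ← Finset.mul_sum, ← Finset.sum_mul,
    sum_lam_mul hr hF, hF]
  split_ifs <;> push_cast <;> ring

theorem sum_ite_trace_eq_zero (hF : Fintype.card F = 2 ^ r) :
    ∑ g : SpecialLinearGroup (Fin 2) F, (if g.1 0 0 + g.1 1 1 = 0 then 1 else 0 : ℤ) =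
      (2 ^ r) ^ 2 := by
  rw [sum_specialLinearGroup fun x w => if x + w = 0 then 1 else 0]
  simp only [units_add_inv_eq_zero_iff, Finset.sum_ite_eq', Finset.mem_univ, if_true]
  simp only [CharTwo.add_eq_zero, Finset.sum_ite_eq, Finset.mem_univ, if_true, Finset.sum_const,
    Finset.card_univ, hF]
  push_cast [nsmul_eq_mul]
  ring

theorem sum_lam_trace_mul_trace (hr : 1 ≤ r) (hF : Fintype.card F = 2 ^ r) {a : F} (ha : a ≠ 0) :
    ∑ g : SpecialLinearGroup (Fin 2) F, ∑ h : SpecialLinearGroup (Fin 2) F,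
      lam F r (a * (g.1 0 0 + g.1 1 1) * (h.1 0 0 + h.1 1 1)) =
      (2 ^ r) ^ 2 * ((2 ^ r) ^ 3 - 2 ^ r + Kl F r a ^ 2) := by
  have hc : ∀ (g : SpecialLinearGroup (Fin 2) F) (u : Fˣ),
      a * (g.1 0 0 + g.1 1 1) * (u + (u : F)⁻¹) = a * (u + (u : F)⁻¹) * (g.1 0 0 + g.1 1 1) :=
    fun g u => by ring
  have h1 : ∀ x : F, (if x = 0 then (2 ^ r - 1) * (2 ^ r) ^ 2 else 0 : ℤ) =
      (2 ^ r - 1) * (2 ^ r) ^ 2 * if x = 0 then 1 else 0 := fun x => by simp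
  simp only [sum_lam_mul_trace hr hF, Finset.sum_add_distrib, mul_eq_zero, ha, false_or]
  simp only [h1, ← Finset.mul_sum, sum_ite_trace_eq_zero hF]
  rw [Finset.sum_comm]
  simp only [hc, sum_lam_mul_trace hr hF, Finset.sum_add_distrib, mul_eq_zero, ha, false_or,
    units_add_inv_eq_zero_iff, Finset.sum_ite_eq', Finset.mem_univ, if_true, ← Finset.mul_sum,
    sum_sum_lam_add_inv hF ha]
  ring

end SpecialLinear

section TensorAction

variable {F : Type}

/-- Coordinates on `F^4` as `2 × 2` matrices, turning `θ⁺` into the determinant when `-1 = 1`. -/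
def toMatrixTwo (x : Fin 2 ⊕ Fin 2 → F) : Matrix (Fin 2) (Fin 2) F :=
  !![x (Sum.inl 0), x (Sum.inl 1); x (Sum.inr 1), x (Sum.inr 0)]

/-- The inverse of `toMatrixTwo`. -/
def ofMatrixTwo (m : Matrix (Fin 2) (Fin 2) F) : Fin 2 ⊕ Fin 2 → F :=
  Sum.elim ![m 0 0, m 0 1] ![m 1 1, m 1 0]

theorem ofMatrixTwo_toMatrixTwo (x : Fin 2 ⊕ Fin 2 → F) : ofMatrixTwo (toMatrixTwo x) = x := by
  ext i
  rcases i with i | i <;> fin_cases i <;> simp [toMatrixTwo, ofMatrixTwo]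

theorem toMatrixTwo_ofMatrixTwo (m : Matrix (Fin 2) (Fin 2) F) :
    toMatrixTwo (ofMatrixTwo m) = m := by
  ext i j
  fin_cases i <;> fin_cases j <;> simp [toMatrixTwo, ofMatrixTwo]

variable [Field F]

/-- The matrix of `m ↦ g * m * h` on `F^4 ≃ M₂(F)`. -/
def mulLeftRight (g h : Matrix (Fin 2) (Fin 2) F) :
    Matrix (Fin 2 ⊕ Fin 2) (Fin 2 ⊕ Fin 2) F :=
  Matrix.of fun i j => ofMatrixTwo (g * toMatrixTwo (Pi.single j 1) * h) i

/-- The matrix of the transposition on `F^4 ≃ M₂(F)`. -/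
def transposeMatrix (F : Type) [Field F] : Matrix (Fin 2 ⊕ Fin 2) (Fin 2 ⊕ Fin 2) F :=
  Matrix.of fun i j => ofMatrixTwo (toMatrixTwo (Pi.single j 1))ᵀ i

theorem mulLeftRight_mulVec (g h : Matrix (Fin 2) (Fin 2) F) (x : Fin 2 ⊕ Fin 2 → F) :
    mulLeftRight g h *ᵥ x = ofMatrixTwo (g * toMatrixTwo x * h) := by
  ext i
  rcases i with i | i <;> fin_cases i <;>
    simp [mulLeftRight, Matrix.mulVec, dotProduct, toMatrixTwo, ofMatrixTwo, Matrix.mul_apply,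
      Fin.sum_univ_two, Pi.single_apply] <;> ring

theorem mulLeftRight_mul (g h g' h' : Matrix (Fin 2) (Fin 2) F) :
    mulLeftRight g h * mulLeftRight g' h' = mulLeftRight (g * g') (h' * h) := by
  refine Matrix.ext_iff_mulVec.mpr fun x => ?_
  simp only [← Matrix.mulVec_mulVec, mulLeftRight_mulVec, toMatrixTwo_ofMatrixTwo, Matrix.mul_assoc]

theorem mulLeftRight_one : mulLeftRight (1 : Matrix (Fin 2) (Fin 2) F) 1 = 1 := by
  refine Matrix.ext_iff_mulVec.mpr fun x => ?_
  simp [mulLeftRight_mulVec, ofMatrixTwo_toMatrixTwo]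

theorem trace_mulLeftRight (g h : Matrix (Fin 2) (Fin 2) F) :
    (mulLeftRight g h).trace = (g 0 0 + g 1 1) * (h 0 0 + h 1 1) := by
  simp [mulLeftRight, Matrix.trace, toMatrixTwo, ofMatrixTwo, Matrix.mul_apply,
      Fin.sum_univ_two, Pi.single_apply]
  ring

theorem thetaPlus_eq_det [CharP F 2] (x : Fin 2 ⊕ Fin 2 → F) :
    thetaPlus F 2 x = (toMatrixTwo x).det := by
  simp [thetaPlus, toMatrixTwo, Matrix.det_fin_two, Fin.sum_univ_two, CharTwo.sub_eq_add]

theorem delta_mulLeftRight [CharP F 2] (g h : Matrix (Fin 2) (Fin 2) F) :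
    Matrix.trace (Matrix.toBlocks₁₂ (mulLeftRight g h) *
      (Matrix.toBlocks₂₁ (mulLeftRight g h))ᵀ) = 0 := by
  have h2 : (2 : F) = 0 := CharTwo.two_eq_zero
  simp [mulLeftRight, Matrix.trace, toMatrixTwo, ofMatrixTwo, Matrix.mul_apply,
      Fin.sum_univ_two, Pi.single_apply, Matrix.toBlocks₁₂, Matrix.toBlocks₂₁]
  linear_combination (g 0 1 * h 1 0 * g 1 0 * h 0 1 + g 0 1 * g 1 0 * h 0 0 * h 1 1) * h2

theorem delta_mulLeftRight_mul_transposeMatrix [CharP F 2] (g h : Matrix (Fin 2) (Fin 2) F) :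
    Matrix.trace (Matrix.toBlocks₁₂ (mulLeftRight g h * transposeMatrix F) *
      (Matrix.toBlocks₂₁ (mulLeftRight g h * transposeMatrix F))ᵀ) = g.det * h.det := by
  have h2 : (2 : F) = 0 := CharTwo.two_eq_zero
  simp [mulLeftRight, transposeMatrix, Matrix.trace, toMatrixTwo, ofMatrixTwo, Matrix.mul_apply,
      Fin.sum_univ_two, Pi.single_apply, Matrix.toBlocks₁₂, Matrix.toBlocks₂₁, Matrix.det_fin_two]
  linear_combination (g 0 1 * g 1 0 * h 1 1 * h 0 0 + h 1 0 * h 0 1 * g 0 0 * g 1 1) * h2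

theorem toMatrixTwo_sub (x y : Fin 2 ⊕ Fin 2 → F) :
    toMatrixTwo (x - y) = toMatrixTwo x - toMatrixTwo y := by
  ext i j
  fin_cases i <;> fin_cases j <;> simp [toMatrixTwo]

theorem specialLinearGroup_val_mul (g h : SpecialLinearGroup (Fin 2) F) :
    (g * h).1 = g.1 * h.1 :=
  Matrix.SpecialLinearGroup.coe_mul g h

theorem specialLinearGroup_val_inv_mul (g : SpecialLinearGroup (Fin 2) F) :
    (g⁻¹).1 * g.1 = 1 :=
  congrArg Subtype.val (inv_mul_cancel g)

theorem specialLinearGroup_val_mul_inv (g : SpecialLinearGroup (Fin 2) F) :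
    g.1 * (g⁻¹).1 = 1 :=
  congrArg Subtype.val (mul_inv_cancel g)

theorem mulLeftRight_inv_mul (g h : SpecialLinearGroup (Fin 2) F) :
    mulLeftRight (g⁻¹).1 (h⁻¹).1 * mulLeftRight g.1 h.1 = 1 := by
  rw [mulLeftRight_mul, specialLinearGroup_val_inv_mul, specialLinearGroup_val_mul_inv,
    mulLeftRight_one]

theorem mulLeftRight_eq_one [CharP F 2] {g h : SpecialLinearGroup (Fin 2) F}
    (H : mulLeftRight g.1 h.1 = 1) : g = 1 ∧ h = 1 := by
  have hm : ∀ m : Matrix (Fin 2) (Fin 2) F, g.1 * m * h.1 = m := fun m => by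
    have := congrArg toMatrixTwo (congrArg (· *ᵥ ofMatrixTwo m) H)
    simpa [mulLeftRight_mulVec, toMatrixTwo_ofMatrixTwo] using this
  have hgh : g * h = 1 := by
    refine Subtype.ext ?_
    simpa using hm 1
  have hcomm : ∀ m : Matrix (Fin 2) (Fin 2) F, g.1 * m = m * g.1 := fun m => by
    have hhg : h.1 * g.1 = 1 := by
      rw [← specialLinearGroup_val_mul, mul_eq_one_comm.mp hgh]
      rfl
    have := congrArg (· * g.1) (hm m)
    simpa [Matrix.mul_assoc, hhg] using this
  have e1 := hcomm !![0, 1; 0, 0]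
  have e2 := hcomm !![0, 0; 1, 0]
  have h00 := congrFun (congrFun e1 0) 1
  have h10 := congrFun (congrFun e1 1) 1
  have h01 := congrFun (congrFun e2 0) 0
  simp [Matrix.mul_apply, Fin.sum_univ_two] at h00 h10 h01
  have hdet := g.2
  rw [Matrix.det_fin_two, ← h00, h01, h10] at hdet
  have h11 : g.1 0 0 = 1 := CharTwo.sq_injective (by linear_combination hdet)
  have hg : g = 1 := by
    ext i j
    fin_cases i <;> fin_cases j <;> simp [h10, h01, h11, ← h00]
  exact ⟨hg, by simpa [hg] using hgh⟩

theorem mulLeftRight_injective [CharP F 2] :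
    Function.Injective fun p : SpecialLinearGroup (Fin 2) F × SpecialLinearGroup (Fin 2) F =>
      mulLeftRight p.1.1 p.2.1 := by
  rintro ⟨g, h⟩ ⟨g', h'⟩ H
  have H' : mulLeftRight (g⁻¹ * g').1 (h' * h⁻¹).1 = 1 := by
    rw [specialLinearGroup_val_mul, specialLinearGroup_val_mul, ← mulLeftRight_mul,
      ← mulLeftRight_inv_mul g h]
    exact congrArg _ H.symm
  obtain ⟨h1, h2⟩ := mulLeftRight_eq_one H'
  exact Prod.ext (inv_mul_eq_one.mp h1) (mul_inv_eq_one.mp h2).symm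

theorem thetaPlus_mulLeftRight [CharP F 2] (g h : SpecialLinearGroup (Fin 2) F)
    (x : Fin 2 ⊕ Fin 2 → F) :
    thetaPlus F 2 (mulLeftRight g.1 h.1 *ᵥ x) = thetaPlus F 2 x := by
  rw [thetaPlus_eq_det, thetaPlus_eq_det, mulLeftRight_mulVec, toMatrixTwo_ofMatrixTwo,
    Matrix.det_mul, Matrix.det_mul, g.2, h.2, one_mul, mul_one]

theorem exists_specialLinearGroup_diagonalizing [CharP F 2] {e : Matrix (Fin 2) (Fin 2) F}
    (hdet : e.det = 0) (htr : e.trace = 1) :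
    ∃ Q : SpecialLinearGroup (Fin 2) F, e * Q.1 = Q.1 * !![1, 0; 0, 0] := by
  rw [Matrix.det_fin_two] at hdet
  rw [Matrix.trace_fin_two] at htr
  have h11 : e 1 1 = 1 - e 0 0 := by linear_combination htr
  have h2 : (2 : F) = 0 := CharTwo.two_eq_zero
  rw [h11] at hdet
  by_cases hx : e 0 0 = 0
  · rw [hx] at hdet h11
    refine ⟨⟨!![e 0 1, 1; 1, -e 1 0], ?_⟩, ?_⟩
    · rw [Matrix.det_fin_two_of]
      linear_combination hdet - h2
    · ext i j
      fin_cases i <;> fin_cases j <;> simp [Matrix.mul_apply, Fin.sum_univ_two, hx, h11]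
      all_goals exact mul_eq_zero.mp (by linear_combination -hdet)
  · refine ⟨⟨!![1, -e 0 1; e 1 0 / e 0 0, e 0 0], ?_⟩, ?_⟩
    · rw [Matrix.det_fin_two_of]
      field_simp
      linear_combination -hdet
    · ext i j
      fin_cases i <;> fin_cases j <;> simp [Matrix.mul_apply, Fin.sum_univ_two, h11] <;>
        field_simp <;> first | linear_combination hdet | linear_combination -hdet | ring

theorem eq_mulLeftRight_of_fixes [CharP F 2] [Fintype F]
    {w : Matrix (Fin 2 ⊕ Fin 2) (Fin 2 ⊕ Fin 2) F}
    (hw : ∀ x, thetaPlus F 2 (w *ᵥ x) = thetaPlus F 2 x)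
    (h0 : w *ᵥ Pi.single (Sum.inl 0) 1 = Pi.single (Sum.inl 0) 1)
    (h1 : w *ᵥ Pi.single (Sum.inr 0) 1 = Pi.single (Sum.inr 0) 1) :
    ∃ g h : SpecialLinearGroup (Fin 2) F,
      w = mulLeftRight g.1 h.1 ∨ w = mulLeftRight g.1 h.1 * transposeMatrix F := by
  rw [Matrix.mulVec_single_one] at h0 h1
  have c0 : ∀ i, w i (Sum.inl 0) = (Pi.single (Sum.inl 0) 1 : Fin 2 ⊕ Fin 2 → F) i := congrFun h0
  have c1 : ∀ i, w i (Sum.inr 0) = (Pi.single (Sum.inr 0) 1 : Fin 2 ⊕ Fin 2 → F) i := congrFun h1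
  have key : ∀ x0 x1 y0 y1 : F, _ := fun x0 x1 y0 y1 => hw (Sum.elim ![x0, x1] ![y0, y1])
  simp [thetaPlus, Matrix.mulVec, dotProduct, Fin.sum_univ_two, c0, c1, Pi.single_apply] at key
  generalize hp : w (Sum.inl 0) (Sum.inl 1) = p at key
  generalize hq : w (Sum.inl 1) (Sum.inl 1) = q at key
  generalize ht : w (Sum.inr 0) (Sum.inl 1) = t at key
  generalize hs : w (Sum.inr 1) (Sum.inl 1) = s at key
  generalize hp' : w (Sum.inl 0) (Sum.inr 1) = p' at key
  generalize hq' : w (Sum.inl 1) (Sum.inr 1) = q' at key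
  generalize ht' : w (Sum.inr 0) (Sum.inr 1) = t' at key
  generalize hs' : w (Sum.inr 1) (Sum.inr 1) = s' at key
  have k1 := key 0 1 0 0
  have k2 := key 1 1 0 0
  have k3 := key 0 1 1 0
  have k4 := key 0 0 0 1
  have k5 := key 1 0 0 1
  have k6 := key 0 0 1 1
  have k7 := key 0 1 0 1
  simp at k1 k2 k3 k4 k5 k6 k7
  have et : t = 0 := by linear_combination k2 - k1
  have ep : p = 0 := by linear_combination k3 - k1
  have et' : t' = 0 := by linear_combination k5 - k4
  have ep' : p' = 0 := by linear_combination k6 - k4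
  subst et ep et' ep'
  simp at k1 k4 k7
  have hsurj : ∀ b : F, ∃ c, c ^ 2 = b := fun b =>
    (Finite.injective_iff_surjective.mp (CharTwo.sq_injective (R := F))) b
  have hdet : ∀ c : F, c ≠ 0 → (!![c, 0; 0, c⁻¹] : Matrix (Fin 2) (Fin 2) F).det = 1 :=
    fun c hc => by simp [Matrix.det_fin_two_of, hc]
  have hdet' : ∀ c : F, c ≠ 0 → (!![c⁻¹, 0; 0, c] : Matrix (Fin 2) (Fin 2) F).det = 1 :=
    fun c hc => by simp [Matrix.det_fin_two_of, hc]
  rcases k1 with rfl | rfl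
  · have hqs : q' * s = 1 := by
      rcases k4 with rfl | rfl
      · simp at k7
      · simpa using k7
    have hs0 : s' = 0 := by
      rcases k4 with rfl | rfl
      · simp at hqs
      · rfl
    obtain ⟨c, rfl⟩ := hsurj q'
    have hc : c ≠ 0 := by rintro rfl; simp at hqs
    have es : s = c⁻¹ * c⁻¹ := by field_simp; linear_combination hqs
    refine ⟨⟨_, hdet c hc⟩, ⟨_, hdet' c hc⟩, Or.inr ?_⟩
    ext i j
    rcases i with i | i <;> rcases j with j | j <;> fin_cases i <;> fin_cases j <;>
      simp [c0, c1, hp, hq, ht, hs, hp', hq', ht', hs', mulLeftRight, transposeMatrix, toMatrixTwo,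
        ofMatrixTwo, Matrix.mul_apply, Fin.sum_univ_two, Pi.single_apply, hc, hs0, es, sq]
  · have hqs : q * s' = 1 := by
      rcases k4 with rfl | rfl
      · simpa using k7
      · simp at k7
    have hs0 : q' = 0 := by
      rcases k4 with rfl | rfl
      · rfl
      · simp at hqs
    obtain ⟨c, rfl⟩ := hsurj q
    have hc : c ≠ 0 := by rintro rfl; simp at hqs
    have es : s' = c⁻¹ * c⁻¹ := by field_simp; linear_combination hqs
    refine ⟨⟨_, hdet c hc⟩, ⟨_, hdet' c hc⟩, Or.inl ?_⟩
    ext i j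
    rcases i with i | i <;> rcases j with j | j <;> fin_cases i <;> fin_cases j <;>
      simp [c0, c1, hp, hq, ht, hs, hp', hq', ht', hs', mulLeftRight, toMatrixTwo,
        ofMatrixTwo, Matrix.mul_apply, Fin.sum_univ_two, Pi.single_apply, hc, hs0, es, sq]

theorem eq_mulLeftRight_of_isometry [CharP F 2] [Fintype F]
    {w : Matrix (Fin 2 ⊕ Fin 2) (Fin 2 ⊕ Fin 2) F}
    (hw : ∀ x, thetaPlus F 2 (w *ᵥ x) = thetaPlus F 2 x) :
    ∃ g h : SpecialLinearGroup (Fin 2) F,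
      w = mulLeftRight g.1 h.1 ∨ w = mulLeftRight g.1 h.1 * transposeMatrix F := by
  set u : Fin 2 ⊕ Fin 2 → F := Pi.single (Sum.inl 0) 1 with hu
  set v : Fin 2 ⊕ Fin 2 → F := Pi.single (Sum.inr 0) 1 with hv
  have hu' : toMatrixTwo u = !![1, 0; 0, 0] := by simp [toMatrixTwo, hu]
  have hv' : toMatrixTwo v = 1 - !![1, 0; 0, 0] := by
    ext i j
    fin_cases i <;> fin_cases j <;> simp [toMatrixTwo, hv]
  have hdet : ∀ x, (toMatrixTwo (w *ᵥ x)).det = (toMatrixTwo x).det := fun x => by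
    rw [← thetaPlus_eq_det, ← thetaPlus_eq_det, hw]
  have huv : toMatrixTwo (u + v) = 1 := by
    ext i j
    fin_cases i <;> fin_cases j <;> simp [toMatrixTwo, hu, hv]
  let P : SpecialLinearGroup (Fin 2) F := ⟨toMatrixTwo (w *ᵥ (u + v)), by rw [hdet, huv, det_one]⟩
  have hP : (P⁻¹).1 * P.1 = 1 := specialLinearGroup_val_inv_mul P
  let e := (P⁻¹).1 * toMatrixTwo (w *ᵥ u)
  have hv1 : (P⁻¹).1 * toMatrixTwo (w *ᵥ v) = 1 - e := by
    have : w *ᵥ v = w *ᵥ (u + v) - w *ᵥ u := by rw [Matrix.mulVec_add]; abel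
    rw [this, toMatrixTwo_sub, Matrix.mul_sub]
    exact congrArg (· - e) hP
  have he : e.det = 0 := by
    rw [Matrix.det_mul, hdet, hu']
    simp
  have he1 : (1 - e).det = 0 := by
    rw [← hv1, Matrix.det_mul, hdet, hv']
    simp [Matrix.det_fin_two]
  have htr : e.trace = 1 := by
    rw [Matrix.det_fin_two] at he he1
    rw [Matrix.trace_fin_two]
    simp at he1
    linear_combination he - he1
  obtain ⟨Q, hQ⟩ := exists_specialLinearGroup_diagonalizing he htr
  have hQ1 : (Q⁻¹).1 * Q.1 = 1 := specialLinearGroup_val_inv_mul Q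
  have hfix : ∀ x, toMatrixTwo (mulLeftRight (Q⁻¹ * P⁻¹).1 Q.1 *ᵥ (w *ᵥ x)) =
      (Q⁻¹).1 * ((P⁻¹).1 * toMatrixTwo (w *ᵥ x) * Q.1) := fun x => by
    rw [mulLeftRight_mulVec, toMatrixTwo_ofMatrixTwo, specialLinearGroup_val_mul]
    simp only [Matrix.mul_assoc]
  have hinj : Function.Injective (toMatrixTwo (F := F)) :=
    Function.LeftInverse.injective ofMatrixTwo_toMatrixTwo
  obtain ⟨g, h, H⟩ := eq_mulLeftRight_of_fixes (w := mulLeftRight (Q⁻¹ * P⁻¹).1 Q.1 * w)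
    (fun x => by rw [← Matrix.mulVec_mulVec, thetaPlus_mulLeftRight, hw])
    (by
      refine hinj ?_
      rw [← Matrix.mulVec_mulVec, hfix]
      change (Q⁻¹).1 * (e * Q.1) = _
      rw [hQ, ← Matrix.mul_assoc, hQ1, Matrix.one_mul, ← hu'])
    (by
      refine hinj ?_
      rw [← Matrix.mulVec_mulVec, hfix, hv1, Matrix.sub_mul, Matrix.one_mul, hQ, Matrix.mul_sub,
        ← Matrix.mul_assoc, hQ1, Matrix.one_mul, ← hv'])
  have hback := mulLeftRight_inv_mul (Q⁻¹ * P⁻¹) Q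
  refine ⟨(Q⁻¹ * P⁻¹)⁻¹ * g, h * Q⁻¹, H.imp (fun H => ?_) fun H => ?_⟩
  · rw [specialLinearGroup_val_mul, specialLinearGroup_val_mul, ← mulLeftRight_mul, ← H,
      ← Matrix.mul_assoc, hback, Matrix.one_mul]
  · rw [specialLinearGroup_val_mul, specialLinearGroup_val_mul, ← mulLeftRight_mul,
      Matrix.mul_assoc, ← H, ← Matrix.mul_assoc, hback, Matrix.one_mul]

theorem mem_SOplusGrp_two [CharP F 2] [Fintype F] [DecidableEq F]
    (w : Matrix (Fin 2 ⊕ Fin 2) (Fin 2 ⊕ Fin 2) F) :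
    w ∈ SOplusGrp F 2 ↔ ∃ g h : SpecialLinearGroup (Fin 2) F, w = mulLeftRight g.1 h.1 := by
  simp only [SOplusGrp, OplusGrp, Finset.mem_filter, Finset.mem_univ, true_and]
  constructor
  · rintro ⟨⟨-, hw⟩, hd⟩
    obtain ⟨g, h, rfl | rfl⟩ := eq_mulLeftRight_of_isometry hw
    · exact ⟨g, h, rfl⟩
    · rw [delta_mulLeftRight_mul_transposeMatrix, g.2, h.2] at hd
      simp at hd
  · rintro ⟨g, h, rfl⟩
    exact ⟨⟨IsUnit.of_mul_eq_one_right _ (mulLeftRight_inv_mul g h), thetaPlus_mulLeftRight g h⟩,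
      delta_mulLeftRight g.1 h.1⟩

theorem sum_SOplusGrp_two [CharP F 2] [Fintype F] [DecidableEq F] {M : Type*} [AddCommMonoid M]
    (f : Matrix (Fin 2 ⊕ Fin 2) (Fin 2 ⊕ Fin 2) F → M) :
    ∑ w ∈ SOplusGrp F 2, f w =
      ∑ g : SpecialLinearGroup (Fin 2) F, ∑ h : SpecialLinearGroup (Fin 2) F,
        f (mulLeftRight g.1 h.1) := by
  rw [← Fintype.sum_prod_type']
  symm
  refine Finset.sum_bij (fun p _ => mulLeftRight p.1.1 p.2.1) ?_ ?_ ?_ ?_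
  · rintro ⟨g, h⟩ _
    exact (mem_SOplusGrp_two _).mpr ⟨g, h, rfl⟩
  · intro p _ q _ H
    exact mulLeftRight_injective H
  · intro w hw
    obtain ⟨g, h, rfl⟩ := (mem_SOplusGrp_two w).mp hw
    exact ⟨(g, h), Finset.mem_univ _, rfl⟩
  · intros
    rfl

end TensorAction


theorem two_mul_card_filter_SOplusGrp_two {r : ℕ} (hr : 1 ≤ r) {F : Type} [Field F] [Fintype F]
    [DecidableEq F] [CharP F 2] (hF : Fintype.card F = 2 ^ r) {a : F} (ha : a ≠ 0) :
    2 * (((SOplusGrp F 2).filter fun g => trF F r (a * Matrix.trace g) = 1).card : ℤ) =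
      (2 ^ r) ^ 2 * ((2 ^ r) ^ 4 - (2 ^ r) ^ 3 - 2 * (2 ^ r) ^ 2 + 2 ^ r + 1 - Kl F r a ^ 2) := by
  rw [card_filter_trF_eq_one hF, Finset.card_eq_sum_ones, sum_SOplusGrp_two, sum_SOplusGrp_two]
  simp only [trace_mulLeftRight, ← mul_assoc, sum_lam_trace_mul_trace hr hF ha, Finset.sum_const,
    Finset.card_univ, smul_eq_mul, mul_one]
  push_cast
  rw [card_specialLinearGroup hF]
  ring

theorem stmt18 (r : ℕ) (hr : 1 ≤ r) (F : Type) [Field F] [Fintype F] [DecidableEq F]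
    (hF : Fintype.card F = 2 ^ r) (a : F) (ha : a ≠ 0) :
    ((((SOplusGrp F 2).filter (fun g => trF F r (a * Matrix.trace g) = 1)).card : ℚ) =
      (1 / 2) * (2 ^ r : ℚ) ^ 2 *
        ((2 ^ r : ℚ) ^ 4 - (2 ^ r : ℚ) ^ 3 - 2 * (2 ^ r : ℚ) ^ 2 + (2 ^ r : ℚ) + 1 -
          (Kl F r a : ℚ) ^ 2)) ∧
    ((((SOplusGrp F 2).filter (fun g => trF F r (a * Matrix.trace g) = 1)).card : ℚ) =
      (1 / 2) * (2 ^ r : ℚ) ^ 2 *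
        ((2 ^ r : ℚ) ^ 4 - (2 ^ r : ℚ) ^ 3 - 2 * (2 ^ r : ℚ) ^ 2 + 1 -
          (Klm F r 2 a : ℚ))) := by
  have : CharP F 2 := by
    have h : (2 : F) = 0 := by
      have h := FiniteField.cast_card_eq_zero F
      rw [hF] at h
      push_cast at h
      exact eq_zero_of_pow_eq_zero h
    exact CharTwo.of_one_ne_zero_of_two_eq_zero one_ne_zero h
  have hmain := congrArg (Int.cast : ℤ → ℚ) (two_mul_card_filter_SOplusGrp_two hr hF ha)
  have hK := congrArg (Int.cast : ℤ → ℚ) (Kl_sq hr hF ha)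
  push_cast at hmain hK
  constructor
  · linear_combination hmain / 2
  · linear_combination hmain / 2 - (2 ^ r : ℚ) ^ 2 / 2 * hK
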